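/- Let Q be a finite state space with a stationary, irreducible, aperiodic Markov chain with mixing time bounded by τ, and f : Σ^n → [0,1] a function on observations. For the sliding-window estimator f̂ over a random observed path W of length t ≥ n, and any ε > 0: P(|f̂(W) − E[f̂(W)]| ≥ ε) ≤ 2 exp(−2ε²(t−n+1)² / (t · min(t−n+1, n)² · 9τ)). Consequently, for fixed n, as t → ∞ the right-hand side tends to 0, so f̂(W) converges to E[f̂(W)] in probability. -/

import Mathlib

open scoped Classical
open Filter

/-- Path probability of a finite state sequence under initial distribution `π`
and transition matrix `P`. -/
noncomputable def pathProb {Q : Type*} (π : Q → ℝ) (P : Q → Q → ℝ) (t : ℕ) (ht : 1 ≤ t)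
    (w : Fin t → Q) : ℝ :=
  π (w ⟨0, ht⟩) *
    ∏ j : Fin (t - 1),
      P (w ⟨j.val, by have := j.isLt; omega⟩) (w ⟨j.val + 1, by have := j.isLt; omega⟩)

/-- The sliding-window average estimator `f̂`. -/
noncomputable def slidingAvg {σ : Type*} (n t : ℕ) (hnt : n ≤ t)
    (f : (Fin n → σ) → ℝ) (w : Fin t → σ) : ℝ :=
  (((t - n + 1 : ℕ) : ℝ))⁻¹ *
    ∑ i : Fin (t - n + 1),
      f (fun j => w ⟨i.val + j.val, by have := i.isLt; have := j.isLt; omega⟩)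

/-- `m`-step transition probabilities on a finite state space. -/
noncomputable def matpowF {Q : Type*} [Fintype Q] (P : Q → Q → ℝ) : ℕ → Q → Q → ℝ
  | 0 => fun q q' => if q = q' then 1 else 0
  | (m + 1) => fun q q' => ∑ r, P q r * matpowF P m r q'

/-- Weight of a state sequence whose first entry has law `μ` and whose later entries follow `P`. -/
noncomputable def listWeight {Q : Type*} (P : Q → Q → ℝ) : (Q → ℝ) → List Q → ℝ
  | _, [] => 1
  | μ, y :: l => μ y * listWeight P (P y) l

/-- Law of the next state after observing a sequence, the law of the first state being `μ`. -/
def nextLaw {Q : Type*} (P : Q → Q → ℝ) : (Q → ℝ) → List Q → (Q → ℝ)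
  | μ, [] => μ
  | _, y :: l => nextLaw P (P y) l

/-- Expectation of `G` over the first `m` states of the chain with initial law `μ`. -/
noncomputable def pathExp {Q : Type*} [Fintype Q] (P : Q → Q → ℝ) (μ : Q → ℝ) (m : ℕ)
    (G : List Q → ℝ) : ℝ :=
  ∑ w : Fin m → Q, listWeight P μ (List.ofFn w) * G (List.ofFn w)

/-- Changing one entry of a sequence of length `m` changes `G` by at most `c`. -/
def BoundedDiff {Q : Type*} (c : ℝ) (m : ℕ) (G : List Q → ℝ) : Prop :=
  ∀ a y y' b, a.length + (b.length + 1) = m → G (a ++ y :: b) - G (a ++ y' :: b) ≤ c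

/-- A probability vector on a finite type. -/
def IsProbVec {Q : Type*} [Fintype Q] (μ : Q → ℝ) : Prop :=
  (∀ q, 0 ≤ μ q) ∧ ∑ q, μ q = 1

/-- Hoeffding's lemma for a finitely supported distribution. -/
lemma IsProbVec.hoeffding {ι : Type*} [Fintype ι] {p : ι → ℝ} (hp : IsProbVec p)
    (X : ι → ℝ) (R : ℝ) (hR : ∀ i j, X i - X j ≤ R) (lam : ℝ) :
    ∑ i, p i * Real.exp (lam * X i) ≤
      Real.exp (lam * ∑ i, p i * X i) * Real.exp (lam ^ 2 * R ^ 2 / 8) := by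
  have hne : Nonempty ι := by
    by_contra h
    rw [not_nonempty_iff] at h
    simpa using hp.2
  obtain ⟨j, hj⟩ := Finite.exists_min X
  let _ : MeasurableSpace ι := ⊤
  have hsum : ∑ i, ENNReal.ofReal (p i) = 1 := by
    rw [← ENNReal.ofReal_sum_of_nonneg fun i _ => hp.1 i, hp.2, ENNReal.ofReal_one]
  let ν := (PMF.ofFintype (fun i => ENNReal.ofReal (p i)) hsum).toMeasure
  have hint : ∀ Y : ι → ℝ, ∫ i, Y i ∂ν = ∑ i, p i * Y i := by
    intro Y
    simp [ν, PMF.integral_eq_sum, ENNReal.toReal_ofReal (hp.1 _)]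
  have hsub := ProbabilityTheory.hasSubgaussianMGF_of_mem_Icc (μ := ν) (X := X)
    (a := X j) (b := X j + R) (measurable_of_finite X).aemeasurable
    (Eventually.of_forall fun i => ⟨hj i, by linarith [hR i j]⟩)
  have h := hsub.mgf_le lam
  rw [ProbabilityTheory.mgf, hint, hint] at h
  have hfac : ∑ i, p i * Real.exp (lam * X i) =
      Real.exp (lam * ∑ i, p i * X i) *
        ∑ i, p i * Real.exp (lam * (X i - ∑ i, p i * X i)) := by
    rw [Finset.mul_sum]
    refine Finset.sum_congr rfl fun i _ => ?_
    rw [mul_left_comm, ← Real.exp_add]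
    ring_nf
  rw [hfac]
  refine mul_le_mul_of_nonneg_left (h.trans (Real.exp_le_exp.2 (le_of_eq ?_)))
    (Real.exp_pos _).le
  simp [div_pow]
  ring

/-- Expectations of `K` under two probability vectors differ by at most the total variation
distance times the oscillation of `K`. -/
lemma IsProbVec.sum_sub_sum_le {Q : Type*} [Fintype Q] [Nonempty Q] {p q : Q → ℝ}
    (hp : IsProbVec p) (hq : IsProbVec q) (K : Q → ℝ) (R : ℝ) (hR : ∀ i j, K i - K j ≤ R) :
    ∑ z, p z * K z - ∑ z, q z * K z ≤ (∑ z, |p z - q z|) / 2 * R := by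
  obtain ⟨j, hj⟩ := Finite.exists_min K
  have h1 : ∑ z, p z * K z - ∑ z, q z * K z =
      ∑ z, (p z - q z) * (K z - (K j + R / 2)) := by
    simp only [sub_mul, mul_sub, Finset.sum_sub_distrib, ← Finset.sum_mul, hp.2, hq.2]
    ring
  rw [h1, div_mul_eq_mul_div, mul_div_assoc, Finset.sum_mul]
  refine Finset.sum_le_sum fun z _ => (le_abs_self _).trans ?_
  rw [abs_mul]
  refine mul_le_mul_of_nonneg_left ?_ (abs_nonneg _)
  rw [abs_le]
  constructor <;> linarith [hj z, hR z j]

lemma BoundedDiff.neg {Q : Type*} {c : ℝ} {m : ℕ} {G : List Q → ℝ} (hG : BoundedDiff c m G) :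
    BoundedDiff c m (fun l => -G l) := by
  intro a y y' b h
  have := hG a y' y b h
  simp only
  linarith

lemma BoundedDiff.comp_append {Q : Type*} {c : ℝ} {k b : ℕ} {G : List Q → ℝ}
    (hG : BoundedDiff c (k + b) G) {l : List Q} (hl : l.length = k) :
    BoundedDiff c b (fun l' => G (l ++ l')) := by
  intro a y y' d h
  have := hG (l ++ a) y y' d (by simp; omega)
  simpa using this

/-- Changing `k` consecutive entries changes a function with bounded differences by at most
`k * c`. -/
lemma BoundedDiff.replace {Q : Type*} {c : ℝ} {m : ℕ} {G : List Q → ℝ}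
    (hG : BoundedDiff c m G) (k : ℕ) : ∀ a l l' b : List Q, l.length = k → l'.length = k →
    a.length + (k + b.length) = m → G (a ++ (l ++ b)) - G (a ++ (l' ++ b)) ≤ k * c := by
  induction k with
  | zero =>
    intro a l l' b hl hl' _
    rw [List.length_eq_zero_iff] at hl hl'
    simp [hl, hl']
  | succ k ih =>
    intro a l l' b hl hl' h
    obtain ⟨y, l, rfl⟩ := List.exists_cons_of_length_eq_add_one hl
    obtain ⟨y', l', rfl⟩ := List.exists_cons_of_length_eq_add_one hl'
    simp only [List.length_cons, Nat.add_right_cancel_iff] at hl hl'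
    have h1 := hG a y y' (l ++ b) (by simp; omega)
    have h2 := ih (a ++ [y']) l l' b hl hl' (by simp; omega)
    simp only [List.append_assoc, List.cons_append, List.nil_append] at h2 ⊢
    push_cast
    linarith

lemma BoundedDiff.osc {Q : Type*} {c : ℝ} {m : ℕ} {G : List Q → ℝ}
    (hG : BoundedDiff c m G) {l l' : List Q} (hl : l.length = m) (hl' : l'.length = m) :
    G l - G l' ≤ m * c := by
  simpa using hG.replace m [] l l' [] hl hl' (by simp)

section Chain

variable {Q : Type*} [Fintype Q] {P : Q → Q → ℝ}

lemma listWeight_nonneg (hP : ∀ q, IsProbVec (P q)) (l : List Q) :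
    ∀ {μ : Q → ℝ}, IsProbVec μ → 0 ≤ listWeight P μ l := by
  induction l with
  | nil => intro μ _; simp [listWeight]
  | cons y l ih => intro μ hμ; exact mul_nonneg (hμ.1 y) (ih (hP y))

lemma nextLaw_isProbVec (hP : ∀ q, IsProbVec (P q)) (l : List Q) :
    ∀ {μ : Q → ℝ}, IsProbVec μ → IsProbVec (nextLaw P μ l) := by
  induction l with
  | nil => intro μ hμ; exact hμ
  | cons y l ih => intro μ _; exact ih (hP y)

lemma exists_nextLaw_eq {Q : Type*} (P : Q → Q → ℝ) (l : List Q) (hl : l ≠ []) :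
    ∃ x, ∀ μ, nextLaw P μ l = P x := by
  induction l with
  | nil => exact absurd rfl hl
  | cons y l ih =>
    rcases eq_or_ne l [] with rfl | h
    · exact ⟨y, fun _ => rfl⟩
    · obtain ⟨x, hx⟩ := ih h
      exact ⟨x, fun _ => hx _⟩

lemma pathExp_zero (μ : Q → ℝ) (G : List Q → ℝ) : pathExp P μ 0 G = G [] := by
  simp [pathExp, listWeight]

lemma pathExp_succ (μ : Q → ℝ) (m : ℕ) (G : List Q → ℝ) :
    pathExp P μ (m + 1) G = ∑ y, μ y * pathExp P (P y) m (fun l => G (y :: l)) := by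
  unfold pathExp
  rw [← (Fin.consEquiv fun _ => Q).sum_comp, Fintype.sum_prod_type]
  refine Finset.sum_congr rfl fun y _ => ?_
  rw [Finset.mul_sum]
  refine Finset.sum_congr rfl fun w _ => ?_
  simp [Fin.consEquiv, listWeight, List.ofFn_succ, mul_assoc]

lemma pathExp_add (b : ℕ) (a : ℕ) : ∀ (μ : Q → ℝ) (G : List Q → ℝ),
    pathExp P μ (a + b) G =
      pathExp P μ a (fun l => pathExp P (nextLaw P μ l) b (fun l' => G (l ++ l'))) := by
  induction a with
  | zero => intro μ G; simp [pathExp_zero, nextLaw]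
  | succ a ih =>
    intro μ G
    rw [show a + 1 + b = (a + b) + 1 by omega, pathExp_succ, pathExp_succ]
    refine Finset.sum_congr rfl fun y _ => ?_
    rw [ih]
    rfl

lemma pathExp_mono (hP : ∀ q, IsProbVec (P q)) {μ : Q → ℝ} (hμ : IsProbVec μ) {m : ℕ}
    {G G' : List Q → ℝ} (h : ∀ l, l.length = m → G l ≤ G' l) :
    pathExp P μ m G ≤ pathExp P μ m G' :=
  Finset.sum_le_sum fun w _ =>
    mul_le_mul_of_nonneg_left (h _ (by simp)) (listWeight_nonneg hP _ hμ)

lemma pathExp_const (hP : ∀ q, IsProbVec (P q)) (C : ℝ) (m : ℕ) :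
    ∀ {μ : Q → ℝ}, IsProbVec μ → pathExp P μ m (fun _ => C) = C := by
  induction m with
  | zero => intro μ _; simp [pathExp_zero]
  | succ m ih =>
    intro μ hμ
    simp [pathExp_succ, ih (hP _), ← Finset.sum_mul, hμ.2]

lemma pathExp_add_const (hP : ∀ q, IsProbVec (P q)) {μ : Q → ℝ} (hμ : IsProbVec μ) (m : ℕ)
    (G : List Q → ℝ) (C : ℝ) :
    pathExp P μ m (fun l => G l + C) = pathExp P μ m G + C := by
  have h := pathExp_const hP C m hμ
  simp only [pathExp] at h ⊢
  simp only [mul_add, Finset.sum_add_distrib, h]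

lemma pathExp_mul_const (μ : Q → ℝ) (m : ℕ) (G : List Q → ℝ) (C : ℝ) :
    pathExp P μ m (fun l => G l * C) = pathExp P μ m G * C := by
  simp [pathExp, Finset.sum_mul, mul_assoc]

lemma listWeight_isProbVec (hP : ∀ q, IsProbVec (P q)) {μ : Q → ℝ} (hμ : IsProbVec μ) (m : ℕ) :
    IsProbVec (fun w : Fin m → Q => listWeight P μ (List.ofFn w)) :=
  ⟨fun _ => listWeight_nonneg hP _ hμ, by simpa [pathExp] using pathExp_const hP 1 m hμ⟩

/-- If `G` varies by at most `R`, so do its expectations. -/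
lemma pathExp_sub_le_of_osc [Nonempty Q] (hP : ∀ q, IsProbVec (P q)) {μ μ' : Q → ℝ}
    (hμ : IsProbVec μ) (hμ' : IsProbVec μ') {m : ℕ} {G : List Q → ℝ} {R : ℝ}
    (h : ∀ l l', l.length = m → l'.length = m → G l - G l' ≤ R) :
    pathExp P μ m G - pathExp P μ' m G ≤ R := by
  obtain ⟨w, hw⟩ := Finite.exists_min fun w : Fin m → Q => G (List.ofFn w)
  have h1 : pathExp P μ m G ≤ G (List.ofFn w) + R := by
    rw [← pathExp_const hP (G (List.ofFn w) + R) m hμ]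
    exact pathExp_mono hP hμ fun l hl => by linarith [h l (List.ofFn w) hl (by simp)]
  have h2 : G (List.ofFn w) ≤ pathExp P μ' m G := by
    rw [← pathExp_const hP (G (List.ofFn w)) m hμ']
    refine Finset.sum_le_sum fun v _ =>
      mul_le_mul_of_nonneg_left (hw v) (listWeight_nonneg hP _ hμ')
  linarith

lemma matpowF_isProbVec (hP : ∀ q, IsProbVec (P q)) (m : ℕ) :
    ∀ q, IsProbVec (matpowF P m q) := by
  induction m with
  | zero =>
    refine fun q => ⟨fun r => ?_, by simp [matpowF]⟩
    simp only [matpowF]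
    split_ifs <;> norm_num
  | succ m ih =>
    refine fun q => ⟨fun r => Finset.sum_nonneg fun z _ => mul_nonneg ((hP q).1 z) ((ih z).1 r), ?_⟩
    simp only [matpowF]
    rw [Finset.sum_comm]
    simp [← Finset.mul_sum, (ih _).2, (hP q).2]

/-- The law of the state reached after `k` further steps is given by the `k`-step transition
probabilities. -/
lemma pathExp_nextLaw (K : Q → ℝ) (k : ℕ) : ∀ μ : Q → ℝ,
    pathExp P μ k (fun l => ∑ z, nextLaw P μ l z * K z) =
      ∑ y, μ y * ∑ z, matpowF P k y z * K z := by
  induction k with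
  | zero => intro μ; simp [pathExp_zero, nextLaw, matpowF]
  | succ k ih =>
    intro μ
    rw [pathExp_succ]
    refine Finset.sum_congr rfl fun y _ => ?_
    have := ih (P y)
    simp only [nextLaw, this, matpowF, Finset.mul_sum, Finset.sum_mul]
    rw [Finset.sum_comm]
    simp [mul_assoc]

/-- Dependence of the expectation on the starting state, when `s + 1` steps contract the total
variation distance by a factor of two. -/
lemma pathExp_start_sub_le [Nonempty Q] (hP : ∀ q, IsProbVec (P q)) {s : ℕ}
    (hmix : ∀ x x', (∑ z, |matpowF P (s + 1) x z - matpowF P (s + 1) x' z|) / 2 ≤ 1 / 2)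
    {c : ℝ} (hc : 0 ≤ c) (m : ℕ) : ∀ (G : List Q → ℝ), BoundedDiff c m G → ∀ x x',
    pathExp P (P x) m G - pathExp P (P x') m G ≤ 2 * (s + 1) * c := by
  induction m using Nat.strong_induction_on with
  | _ m ih =>
  intro G hG x x'
  rcases Nat.lt_or_ge m (s + 1) with hm | hm
  · have h1 := pathExp_sub_le_of_osc hP (hP x) (hP x') (G := G)
      fun l l' (hl : l.length = m) hl' => hG.osc hl hl'
    have h2 : (m : ℝ) ≤ s + 1 := by exact_mod_cast hm.le
    nlinarith
  obtain ⟨b, rfl⟩ : ∃ b, m = s + (b + 1) := ⟨m - (s + 1), by omega⟩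
  let F : List Q → ℝ := fun l' => ⨆ w : Fin s → Q, G (List.ofFn w ++ l')
  have hle : ∀ l l' : List Q, l.length = s → G (l ++ l') ≤ F l' := by
    rintro l l' rfl
    have := le_ciSup (Set.finite_range fun w : Fin l.length → Q => G (List.ofFn w ++ l')).bddAbove
      l.get
    simpa [F] using this
  have hge : ∀ l l' : List Q, l.length = s → l'.length = b + 1 →
      F l' ≤ G (l ++ l') + s * c := by
    intro l l' hl hl'
    refine ciSup_le fun w => ?_
    have := hG.replace s [] (List.ofFn w) l l' (by simp) hl (by simp [hl'])
    simp only [List.nil_append] at this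
    linarith
  have hF : BoundedDiff c (b + 1) F := by
    intro a y y' d h
    rw [sub_le_iff_le_add]
    refine ciSup_le fun w => ?_
    have h1 := hG.comp_append (l := List.ofFn w) (by simp) a y y' d h
    have h2 := hle (List.ofFn w) (a ++ y' :: d) (by simp)
    linarith
  let K : Q → ℝ := fun z => pathExp P (P z) b (fun l => F (z :: l))
  have hK : ∀ z z', K z - K z' ≤ c + 2 * (s + 1) * c := by
    intro z z'
    have h1 : K z ≤ pathExp P (P z) b (fun l => F (z' :: l)) + c := by
      rw [← pathExp_add_const hP (hP z)]
      refine pathExp_mono hP (hP z) fun l hl => ?_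
      have := hF [] z z' l (by simp [hl])
      simp only [List.nil_append] at this
      linarith
    have h2 := ih b (by omega) (fun l => F (z' :: l))
      (by
        have h : BoundedDiff c (1 + b) F := by rwa [add_comm]
        exact h.comp_append (l := [z']) rfl) z z'
    simp only [K] at h1 ⊢
    linarith
  have hlaw : ∀ x, pathExp P (P x) s (fun l => pathExp P (nextLaw P (P x) l) (b + 1) F) =
      ∑ z, matpowF P (s + 1) x z * K z := by
    intro x
    simp only [pathExp_succ]
    rw [pathExp_nextLaw K s]
    simp only [matpowF, Finset.mul_sum, Finset.sum_mul]
    rw [Finset.sum_comm]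
    simp [mul_assoc]
  have hup : pathExp P (P x) (s + (b + 1)) G ≤ ∑ z, matpowF P (s + 1) x z * K z := by
    rw [← hlaw, pathExp_add]
    exact pathExp_mono hP (hP x) fun l hl =>
      pathExp_mono hP (nextLaw_isProbVec hP l (hP x)) fun l' _ => hle l l' hl
  have hlow : ∑ z, matpowF P (s + 1) x' z * K z ≤
      pathExp P (P x') (s + (b + 1)) G + s * c := by
    rw [← hlaw, pathExp_add, ← pathExp_add_const hP (hP x')]
    refine pathExp_mono hP (hP x') fun l hl => ?_
    rw [← pathExp_add_const hP (nextLaw_isProbVec hP l (hP x'))]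
    exact pathExp_mono hP (nextLaw_isProbVec hP l (hP x')) fun l' hl' => hge l l' hl hl'
  have htv := (matpowF_isProbVec hP (s + 1) x).sum_sub_sum_le (matpowF_isProbVec hP (s + 1) x')
    K _ hK
  have hR : 0 ≤ c + 2 * (s + 1) * c := by positivity
  have := mul_le_mul_of_nonneg_right (hmix x x') hR
  linarith

lemma pathExp_hoeffding (hP : ∀ q, IsProbVec (P q)) {μ : Q → ℝ} (hμ : IsProbVec μ) {m : ℕ}
    {G : List Q → ℝ} {R : ℝ} (h : ∀ l l', l.length = m → l'.length = m → G l - G l' ≤ R)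
    (lam : ℝ) :
    pathExp P μ m (fun l => Real.exp (lam * G l)) ≤
      Real.exp (lam * pathExp P μ m G) * Real.exp (lam ^ 2 * R ^ 2 / 8) :=
  (listWeight_isProbVec hP hμ m).hoeffding (fun w => G (List.ofFn w)) R
    (fun _ _ => h _ _ (by simp) (by simp)) lam

/-- Sub-Gaussian bound on the exponential moments of a function with bounded differences of a
Markov chain. -/
lemma pathExp_exp_le [Nonempty Q] (hP : ∀ q, IsProbVec (P q)) {s : ℕ}
    (hmix : ∀ x x', (∑ z, |matpowF P (s + 1) x z - matpowF P (s + 1) x' z|) / 2 ≤ 1 / 2)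
    {c : ℝ} (hc : 0 ≤ c) (lam : ℝ) (m : ℕ) : ∀ (μ : Q → ℝ) (G : List Q → ℝ), IsProbVec μ →
    BoundedDiff c m G →
    pathExp P μ m (fun l => Real.exp (lam * G l)) ≤
      Real.exp (lam * pathExp P μ m G) *
        Real.exp (lam ^ 2 * (m * c ^ 2 * (9 * (s + 1))) / 8) := by
  induction m using Nat.strong_induction_on with
  | _ m ih =>
  intro μ G hμ hG
  rcases Nat.lt_or_ge m (s + 1) with hm | hm
  · refine (pathExp_hoeffding hP hμ (fun l l' hl hl' => hG.osc hl hl') lam).trans ?_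
    have h2 : (m : ℝ) ≤ 9 * (s + 1) := by
      have : (m : ℝ) ≤ s + 1 := by exact_mod_cast hm.le
      linarith
    gcongr
    calc (m * c) ^ 2 = m * c ^ 2 * m := by ring
      _ ≤ m * c ^ 2 * (9 * (s + 1)) := by gcongr
  obtain ⟨b, rfl⟩ : ∃ b, m = (s + 1) + b := ⟨m - (s + 1), by omega⟩
  let H : List Q → ℝ := fun l => pathExp P (nextLaw P μ l) b (fun l' => G (l ++ l'))
  have hH : ∀ l l', l.length = s + 1 → l'.length = s + 1 → H l - H l' ≤ 3 * (s + 1) * c := by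
    intro l l' hl hl'
    have h1 : H l ≤ pathExp P (nextLaw P μ l) b (fun d => G (l' ++ d)) + (s + 1) * c := by
      rw [← pathExp_add_const hP (nextLaw_isProbVec hP l hμ)]
      refine pathExp_mono hP (nextLaw_isProbVec hP l hμ) fun d hd => ?_
      have := hG.replace (s + 1) [] l l' d hl hl' (by simp [hd])
      simp only [List.nil_append] at this
      push_cast at this
      linarith
    obtain ⟨x, hx⟩ := exists_nextLaw_eq P l (by rintro rfl; simp at hl)
    obtain ⟨x', hx'⟩ := exists_nextLaw_eq P l' (by rintro rfl; simp at hl')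
    have h2 := pathExp_start_sub_le hP hmix hc b _ (hG.comp_append hl') x x'
    simp only [H, hx, hx'] at h1 ⊢
    linarith
  rw [pathExp_add b (s + 1), pathExp_add b (s + 1)]
  calc pathExp P μ (s + 1) (fun l => pathExp P (nextLaw P μ l) b
        (fun l' => Real.exp (lam * G (l ++ l'))))
      ≤ pathExp P μ (s + 1) (fun l => Real.exp (lam * H l) *
          Real.exp (lam ^ 2 * (b * c ^ 2 * (9 * (s + 1))) / 8)) :=
        pathExp_mono hP hμ fun l hl => ih b (by omega) _ _ (nextLaw_isProbVec hP l hμ)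
          (hG.comp_append hl)
    _ ≤ (Real.exp (lam * pathExp P μ (s + 1) H) *
          Real.exp (lam ^ 2 * (3 * (s + 1) * c) ^ 2 / 8)) *
          Real.exp (lam ^ 2 * (b * c ^ 2 * (9 * (s + 1))) / 8) := by
        rw [pathExp_mul_const]
        exact mul_le_mul_of_nonneg_right (pathExp_hoeffding hP hμ hH lam) (Real.exp_pos _).le
    _ = _ := by
        rw [mul_assoc, ← Real.exp_add]
        congr 2
        push_cast
        ring

/-- One-sided Chernoff bound for a function with bounded differences of a Markov chain. -/
lemma pathExp_tail_le [Nonempty Q] (hP : ∀ q, IsProbVec (P q)) {s : ℕ}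
    (hmix : ∀ x x', (∑ z, |matpowF P (s + 1) x z - matpowF P (s + 1) x' z|) / 2 ≤ 1 / 2)
    {c : ℝ} (hc : 0 < c) {m : ℕ} (hm : 0 < m) {μ : Q → ℝ} (hμ : IsProbVec μ)
    {G : List Q → ℝ} (hG : BoundedDiff c m G) {ε : ℝ} (hε : 0 < ε) :
    pathExp P μ m (fun l => if ε ≤ G l - pathExp P μ m G then 1 else 0) ≤
      Real.exp (-(2 * ε ^ 2) / (m * c ^ 2 * (9 * (s + 1)))) := by
  set V : ℝ := m * c ^ 2 * (9 * (s + 1)) with hV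
  have hVpos : 0 < V := by
    have : (0 : ℝ) < m := by exact_mod_cast hm
    positivity
  set e := pathExp P μ m G
  calc pathExp P μ m (fun l => if ε ≤ G l - e then 1 else 0)
      ≤ pathExp P μ m (fun l => Real.exp (4 * ε / V * G l) *
          Real.exp (-(4 * ε / V) * (e + ε))) := by
        refine pathExp_mono hP hμ fun l _ => ?_
        rw [← Real.exp_add]
        split_ifs with h
        · rw [Real.one_le_exp_iff]
          have : 0 ≤ 4 * ε / V * (G l - e - ε) := mul_nonneg (by positivity) (by linarith)
          linarith
        · positivity
    _ ≤ (Real.exp (4 * ε / V * e) * Real.exp ((4 * ε / V) ^ 2 * V / 8)) *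
          Real.exp (-(4 * ε / V) * (e + ε)) := by
        rw [pathExp_mul_const]
        exact mul_le_mul_of_nonneg_right (pathExp_exp_le hP hmix hc.le _ m μ G hμ hG)
          (Real.exp_pos _).le
    _ = _ := by
        rw [← Real.exp_add, ← Real.exp_add]
        congr 1
        field_simp
        ring

/-- Two-sided McDiarmid inequality for a Markov chain. -/
lemma pathExp_abs_tail_le [Nonempty Q] (hP : ∀ q, IsProbVec (P q)) {s : ℕ}
    (hmix : ∀ x x', (∑ z, |matpowF P (s + 1) x z - matpowF P (s + 1) x' z|) / 2 ≤ 1 / 2)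
    {c : ℝ} (hc : 0 < c) {m : ℕ} (hm : 0 < m) {μ : Q → ℝ} (hμ : IsProbVec μ)
    {G : List Q → ℝ} (hG : BoundedDiff c m G) {ε : ℝ} (hε : 0 < ε) :
    pathExp P μ m (fun l => if ε ≤ |G l - pathExp P μ m G| then 1 else 0) ≤
      2 * Real.exp (-(2 * ε ^ 2) / (m * c ^ 2 * (9 * (s + 1)))) := by
  have h1 := pathExp_tail_le hP hmix hc hm hμ hG hε
  have h2 := pathExp_tail_le hP hmix hc hm hμ hG.neg hε
  have hneg : pathExp P μ m (fun l => -G l) = -pathExp P μ m G := by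
    simp [pathExp, Finset.sum_neg_distrib]
  rw [hneg] at h2
  have hadd : ∀ F F' : List Q → ℝ,
      pathExp P μ m F + pathExp P μ m F' = pathExp P μ m (fun l => F l + F' l) := by
    intro F F'
    simp only [pathExp, mul_add, Finset.sum_add_distrib]
  rw [two_mul]
  refine le_trans ?_ (add_le_add h1 h2)
  rw [hadd]
  refine pathExp_mono hP hμ fun l _ => ?_
  rw [show -G l - -pathExp P μ m G = -(G l - pathExp P μ m G) by ring]
  rcases abs_cases (G l - pathExp P μ m G) with ⟨h, _⟩ | ⟨h, _⟩ <;> rw [h] <;>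
    split_ifs <;> norm_num

end Chain

/-- The sliding-window average of the labels of a sequence of states, entries beyond the end being
read as `q₀`. -/
noncomputable def listSlidingAvg {Q σ : Type*} (q₀ : Q) (ℓ : Q → σ) (n t : ℕ)
    (f : (Fin n → σ) → ℝ) (l : List Q) : ℝ :=
  ((t - n + 1 : ℕ) : ℝ)⁻¹ *
    ∑ i : Fin (t - n + 1), f (fun j => ℓ (l.getD (i.val + j.val) q₀))

lemma listSlidingAvg_ofFn {Q σ : Type*} (q₀ : Q) (ℓ : Q → σ) (n t : ℕ) (hnt : n ≤ t)
    (f : (Fin n → σ) → ℝ) (w : Fin t → Q) :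
    listSlidingAvg q₀ ℓ n t f (List.ofFn w) = slidingAvg n t hnt f (fun k => ℓ (w k)) := by
  unfold listSlidingAvg slidingAvg
  congr 1
  refine Finset.sum_congr rfl fun i _ => ?_
  congr 1
  funext j
  have hi : i.val + j.val < t := by
    have := i.isLt
    have := j.isLt
    omega
  simp [List.getD_eq_getElem?_getD, hi]

lemma listSlidingAvg_boundedDiff {Q σ : Type*} (q₀ : Q) (ℓ : Q → σ) (n t : ℕ)
    (f : (Fin n → σ) → ℝ) (hf : ∀ v, f v ∈ Set.Icc (0 : ℝ) 1) :
    BoundedDiff (((min (t - n + 1) n : ℕ) : ℝ) / ((t - n + 1 : ℕ) : ℝ)) t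
      (listSlidingAvg q₀ ℓ n t f) := by
  intro a y y' b _
  unfold listSlidingAvg
  rw [← mul_sub, ← Finset.sum_sub_distrib, div_eq_inv_mul]
  refine mul_le_mul_of_nonneg_left ?_ (by positivity)
  let S : Finset (Fin (t - n + 1)) :=
    Finset.univ.filter fun i => i.val ≤ a.length ∧ a.length < i.val + n
  have hcard : S.card ≤ min (t - n + 1) n := by
    refine le_min ((Finset.card_le_univ S).trans (by simp)) ?_
    calc S.card = (S.map Fin.valEmbedding).card := (Finset.card_map _).symm
      _ ≤ (Finset.Ico (a.length + 1 - n) (a.length + 1)).card := by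
        refine Finset.card_le_card fun k hk => ?_
        simp only [S, Finset.mem_map, Finset.mem_filter, Finset.mem_univ, true_and,
          Fin.valEmbedding_apply] at hk
        obtain ⟨i, hi, rfl⟩ := hk
        rw [Finset.mem_Ico]
        omega
      _ ≤ n := by
        rw [Nat.card_Ico]
        omega
  calc ∑ i : Fin (t - n + 1), (f (fun j => ℓ ((a ++ y :: b).getD (i.val + j.val) q₀)) -
        f (fun j => ℓ ((a ++ y' :: b).getD (i.val + j.val) q₀)))
      ≤ ∑ i : Fin (t - n + 1), if i ∈ S then (1 : ℝ) else 0 := by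
        refine Finset.sum_le_sum fun i _ => ?_
        split_ifs with hi
        · linarith [(hf (fun j => ℓ ((a ++ y :: b).getD (i.val + j.val) q₀))).2,
            (hf (fun j => ℓ ((a ++ y' :: b).getD (i.val + j.val) q₀))).1]
        · refine le_of_eq (sub_eq_zero.2 ?_)
          congr 1
          funext j
          have hne : i.val + j.val ≠ a.length := by
            have := j.isLt
            simp only [S, Finset.mem_filter, Finset.mem_univ, true_and] at hi
            omega
          rcases lt_or_gt_of_ne hne with h | h
          · simp [List.getD_eq_getElem?_getD, List.getElem?_append_left h]
          · obtain ⟨k, hk⟩ : ∃ k, i.val + j.val = a.length + (k + 1) :=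
              ⟨i.val + j.val - a.length - 1, by omega⟩
            simp [List.getD_eq_getElem?_getD, hk, List.getElem?_append_right]
    _ = (S.card : ℝ) := by simp
    _ ≤ _ := by exact_mod_cast hcard

lemma listWeight_ofFn_succ {Q : Type*} (P : Q → Q → ℝ) (k : ℕ) :
    ∀ (μ : Q → ℝ) (w : Fin (k + 1) → Q), listWeight P μ (List.ofFn w) =
      μ (w 0) * ∏ j : Fin k, P (w j.castSucc) (w j.succ) := by
  induction k with
  | zero => intro μ w; simp [listWeight, List.ofFn_succ]
  | succ k ih =>
    intro μ w
    rw [List.ofFn_succ, listWeight, ih, Fin.prod_univ_succ]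
    simp

lemma pathProb_eq_listWeight {Q : Type*} (π : Q → ℝ) (P : Q → Q → ℝ) (t : ℕ) (ht : 1 ≤ t)
    (w : Fin t → Q) : pathProb π P t ht w = listWeight P π (List.ofFn w) := by
  obtain ⟨k, rfl⟩ : ∃ k, t = k + 1 := ⟨t - 1, by omega⟩
  rw [listWeight_ofFn_succ]
  rfl

lemma tendsto_mcdiarmid_bound (τ : ℕ) (hτ : 1 ≤ τ) (n : ℕ) (hn : 1 ≤ n) (ε : ℝ) (hε : 0 < ε) :
    Tendsto
      (fun t : ℕ => 2 * Real.exp (-(2 * ε ^ 2 * ((t - n + 1 : ℕ) : ℝ) ^ 2) /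
          ((t : ℝ) * ((min (t - n + 1) n : ℕ) : ℝ) ^ 2 * (9 * (τ : ℝ)))))
      atTop (nhds 0) := by
  have hnR : (0 : ℝ) < n := by exact_mod_cast hn
  have hτR : (0 : ℝ) < τ := by exact_mod_cast hτ
  have hexp : Tendsto (fun t : ℕ => (2 * ε ^ 2 * ((t - n + 1 : ℕ) : ℝ) ^ 2) /
      ((t : ℝ) * ((min (t - n + 1) n : ℕ) : ℝ) ^ 2 * (9 * (τ : ℝ)))) atTop atTop := by
    have hlin : Tendsto (fun t : ℕ => ε ^ 2 / (18 * n ^ 2 * τ) * (t : ℝ)) atTop atTop :=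
      tendsto_natCast_atTop_atTop.const_mul_atTop (by positivity)
    refine tendsto_atTop_mono' _ ?_ hlin
    filter_upwards [eventually_ge_atTop (2 * n)] with t ht
    have htpos : (0 : ℝ) < t := by exact_mod_cast (by omega : 0 < t)
    have hhalf : (t : ℝ) / 2 ≤ ((t - n + 1 : ℕ) : ℝ) := by
      have : (t : ℝ) ≤ 2 * ((t - n + 1 : ℕ) : ℝ) := by exact_mod_cast (by omega)
      linarith
    rw [min_eq_right (by omega : n ≤ t - n + 1)]
    calc ε ^ 2 / (18 * n ^ 2 * τ) * (t : ℝ)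
        = (2 * ε ^ 2 * ((t : ℝ) / 2) ^ 2) / ((t : ℝ) * (n : ℝ) ^ 2 * (9 * (τ : ℝ))) := by
          field_simp
          ring
      _ ≤ _ := by gcongr
  have := (Real.tendsto_exp_neg_atTop_nhds_zero.comp hexp).const_mul 2
  simpa [Function.comp_def, neg_div] using this

/-- McDiarmid-style concentration for the sliding-window estimator
on a finite stationary, irreducible, aperiodic (here: primitive) Markov chain
with mixing time bounded by `τ`:
`P(|f̂(W) − E[f̂(W)]| ≥ ε) ≤ 2 exp(−2ε²(t−n+1)² / (t · min(t−n+1,n)² · 9τ))`,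
and the right-hand side tends to `0` as `t → ∞` (convergence in probability). -/
theorem markov_mcdiarmid_slidingAvg {Q σ : Type*} [Fintype Q] [Nonempty Q]
    (P : Q → Q → ℝ) (π : Q → ℝ) (ℓ : Q → σ) (τ : ℕ) (hτ : 1 ≤ τ)
    (hPnn : ∀ q q', 0 ≤ P q q') (hProw : ∀ q, ∑ q', P q q' = 1)
    (hπnn : ∀ q, 0 ≤ π q) (hπ1 : ∑ q, π q = 1)
    (hstat : ∀ q', ∑ q, π q * P q q' = π q')
    (hprim : ∃ N, ∀ q q', 0 < matpowF P N q q')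
    (hmix : ∀ m, τ ≤ m → ∀ q, (∑ q', |matpowF P m q q' - π q'|) / 2 ≤ 1 / 4)
    (n : ℕ) (hn : 1 ≤ n) (f : (Fin n → σ) → ℝ)
    (hf : ∀ v, f v ∈ Set.Icc (0 : ℝ) 1) (ε : ℝ) (hε : 0 < ε) :
    (∀ t : ℕ, ∀ hnt : n ≤ t,
      (∑ w : Fin t → Q,
        if ε ≤ |slidingAvg n t hnt f (fun k => ℓ (w k)) -
            ∑ w' : Fin t → Q,
              pathProb π P t (by omega) w' * slidingAvg n t hnt f (fun k => ℓ (w' k))|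
        then pathProb π P t (by omega) w else 0)
      ≤ 2 * Real.exp (-(2 * ε ^ 2 * ((t - n + 1 : ℕ) : ℝ) ^ 2) /
          ((t : ℝ) * ((min (t - n + 1) n : ℕ) : ℝ) ^ 2 * (9 * (τ : ℝ))))) ∧
    Tendsto
      (fun t : ℕ => 2 * Real.exp (-(2 * ε ^ 2 * ((t - n + 1 : ℕ) : ℝ) ^ 2) /
          ((t : ℝ) * ((min (t - n + 1) n : ℕ) : ℝ) ^ 2 * (9 * (τ : ℝ)))))
      atTop (nhds 0) := by
  refine ⟨fun t hnt => ?_, tendsto_mcdiarmid_bound τ hτ n hn ε hε⟩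
  have hP : ∀ q, IsProbVec (P q) := fun q => ⟨hPnn q, hProw q⟩
  obtain ⟨s, rfl⟩ : ∃ s, τ = s + 1 := ⟨τ - 1, by omega⟩
  have hcontract : ∀ x x',
      (∑ z, |matpowF P (s + 1) x z - matpowF P (s + 1) x' z|) / 2 ≤ 1 / 2 := by
    intro x x'
    have h : ∑ z, |matpowF P (s + 1) x z - matpowF P (s + 1) x' z| ≤
        ∑ z, |matpowF P (s + 1) x z - π z| + ∑ z, |matpowF P (s + 1) x' z - π z| := by
      rw [← Finset.sum_add_distrib]
      refine Finset.sum_le_sum fun z _ => ?_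
      rw [abs_sub_comm (matpowF P (s + 1) x' z)]
      exact abs_sub_le _ _ _
    linarith [hmix (s + 1) le_rfl x, hmix (s + 1) le_rfl x']
  let q₀ : Q := Classical.arbitrary Q
  have hN : (0 : ℝ) < ((t - n + 1 : ℕ) : ℝ) := by positivity
  have hM : (0 : ℝ) < ((min (t - n + 1) n : ℕ) : ℝ) := by
    exact_mod_cast lt_min (Nat.succ_pos _) hn
  have htR : (0 : ℝ) < t := by exact_mod_cast (by omega : 0 < t)
  have hmain := pathExp_abs_tail_le hP hcontract (div_pos hM hN) (by omega : 0 < t)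
    ⟨hπnn, hπ1⟩ (listSlidingAvg_boundedDiff q₀ ℓ n t f hf) hε
  simp only [pathExp, listSlidingAvg_ofFn q₀ ℓ n t hnt, mul_ite, mul_one, mul_zero] at hmain
  simp only [pathProb_eq_listWeight]
  refine hmain.trans (le_of_eq ?_)
  congr 2
  push_cast
  field_simp
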